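/- Time-derivative identity for the coupled forward–backward pair: Let D ≥ 0, P > 0 and t < T. Let u, F : [t,T] × ℝ → ℝ be continuous and P-periodic in space. Suppose φ, ρ : [t,T] × ℝ → ℝ are C¹ in time and C² in space with continuous derivatives and P-periodic in space, φ solves ∂_sφ + (1/2)(∂_xφ)² + u ∂_xφ + D ∂_x²φ = F on [t,T] × ℝ, and ρ solves ∂_sρ + ∂_x((u + ∂_xφ)ρ) = D ∂_x²ρ on [t,T] × ℝ. Then for every s ∈ [t,T], (d/ds) ∫₀^P ρ(s,x) φ(s,x) dx = ∫₀^P ((1/2)(∂_xφ(s,x))² + F(s,x)) ρ(s,x) dx. -/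

import Mathlib

open Set MeasureTheory intervalIntegral

/-- Differentiation under the integral sign, within a compact time interval, for a uniformly
bounded time derivative. -/
theorem hasDerivWithinAt_intervalIntegral_of_bound {a b t T C : ℝ} {f f' : ℝ → ℝ → ℝ}
    (hf : ∀ s ∈ Icc t T, Continuous (f s))
    (hf' : ∀ s ∈ Icc t T, ∀ x, HasDerivWithinAt (fun τ => f τ x) (f' s x) (Icc t T) s)
    (hC : ∀ s ∈ Icc t T, ∀ x ∈ uIcc a b, ‖f' s x‖ ≤ C) {s : ℝ} (hs : s ∈ Icc t T) :
    HasDerivWithinAt (fun τ => ∫ x in a..b, f τ x) (∫ x in a..b, f' s x) (Icc t T) s := by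
  rw [hasDerivWithinAt_iff_tendsto_slope]
  have hmem : ∀ᶠ τ in nhdsWithin s (Icc t T \ {s}), τ ∈ Icc t T \ {s} := self_mem_nhdsWithin
  have hlim : Filter.Tendsto (fun τ => ∫ x in a..b, slope (fun r => f r x) s τ)
      (nhdsWithin s (Icc t T \ {s})) (nhds (∫ x in a..b, f' s x)) := by
    refine tendsto_integral_filter_of_dominated_convergence (fun _ => C) ?_ ?_
      intervalIntegrable_const ?_
    · filter_upwards [hmem] with τ hτ
      have := hf τ hτ.1
      have := hf s hs
      simp only [slope_def_field]
      exact Continuous.aestronglyMeasurable (by fun_prop)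
    · filter_upwards [hmem] with τ hτ
      refine Filter.Eventually.of_forall fun x hx => ?_
      have hle := (convex_Icc t T).norm_image_sub_le_of_norm_hasDerivWithin_le
        (fun r hr => hf' r hr x) (fun r hr => hC r hr x (uIoc_subset_uIcc hx)) hs hτ.1
      rw [slope_def_field, norm_div]
      exact (div_le_iff₀ (norm_pos_iff.2 (sub_ne_zero.2 hτ.2))).2 hle
    · exact Filter.Eventually.of_forall fun x _ =>
        hasDerivWithinAt_iff_tendsto_slope.1 (hf' s hs x)
  refine hlim.congr' ?_
  filter_upwards [hmem] with τ hτ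
  simp only [slope_def_field]
  rw [intervalIntegral.integral_div, intervalIntegral.integral_sub
    ((hf τ hτ.1).intervalIntegrable _ _) ((hf s hs).intervalIntegrable _ _)]

/-- A function which is continuous in space and has a continuous time derivative is bounded,
together with that derivative, on compact space-time rectangles. -/
theorem exists_bound_of_continuousOn_timeDeriv {a b t T : ℝ} (htT : t ≤ T) {f f' : ℝ → ℝ → ℝ}
    (hf : Continuous (f t))
    (hf' : ∀ s ∈ Icc t T, ∀ x, HasDerivWithinAt (fun τ => f τ x) (f' s x) (Icc t T) s)
    (hf'_cont : ContinuousOn (fun p : ℝ × ℝ => f' p.1 p.2) (Icc t T ×ˢ univ)) :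
    ∃ C, ∀ s ∈ Icc t T, ∀ x ∈ uIcc a b, ‖f s x‖ ≤ C ∧ ‖f' s x‖ ≤ C := by
  obtain ⟨A, hA⟩ := (isCompact_uIcc (a := a) (b := b)).exists_bound_of_continuousOn hf.continuousOn
  obtain ⟨B, hB⟩ := ((isCompact_Icc (a := t) (b := T)).prod
    (isCompact_uIcc (a := a) (b := b))).exists_bound_of_continuousOn
    (hf'_cont.mono (prod_mono_right (subset_univ _)))
  refine ⟨max (A + B * (T - t)) B, fun s hs x hx => ⟨le_max_of_le_left ?_,
    le_max_of_le_right (hB (s, x) ⟨hs, hx⟩)⟩⟩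
  have ht : t ∈ Icc t T := left_mem_Icc.2 htT
  have hB0 : 0 ≤ B := (norm_nonneg _).trans (hB (t, x) ⟨ht, hx⟩)
  have hle := (convex_Icc t T).norm_image_sub_le_of_norm_hasDerivWithin_le
    (fun r hr => hf' r hr x) (fun r hr => hB (r, x) ⟨hr, hx⟩) ht hs
  have hst : ‖s - t‖ ≤ T - t := by
    rw [Real.norm_of_nonneg (sub_nonneg.2 hs.1)]
    linarith [hs.2]
  calc ‖f s x‖ ≤ ‖f t x‖ + ‖f s x - f t x‖ := norm_le_norm_add_norm_sub' _ _
    _ ≤ A + B * (T - t) := add_le_add (hA x hx) (hle.trans (by gcongr))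

/-- The derivative of a periodic function is periodic. -/
theorem hasDerivAt_periodic {P : ℝ} {f f' : ℝ → ℝ} (hf : Function.Periodic f P)
    (hf' : ∀ x, HasDerivAt f (f' x) x) : Function.Periodic f' P := fun x => by
  have h := (hf' (x + P)).comp_add_const x P
  rw [show (fun y => f (y + P)) = f from funext hf] at h
  exact h.unique (hf' x)

/-- Time-derivative identity for the coupled forward–backward pair: if `φ` solves the
backward Hamilton–Jacobi equation and `ρ` solves the forward Fokker–Planck equation
with drift `u + ∂ₓφ`, then for every `s ∈ [t,T]`,
`(d/ds) ∫₀ᴾ ρ(s,·) φ(s,·) = ∫₀ᴾ ((1/2)(∂ₓφ)² + F) ρ(s,·)`. -/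
theorem mfg1_pairing_derivative_identity
    (D P t T : ℝ) (hD : 0 ≤ D) (hP : 0 < P) (htT : t < T)
    (u F : ℝ → ℝ → ℝ)
    (hu_cont : ContinuousOn (fun p : ℝ × ℝ => u p.1 p.2) (Icc t T ×ˢ univ))
    (hF_cont : ContinuousOn (fun p : ℝ × ℝ => F p.1 p.2) (Icc t T ×ˢ univ))
    (hu_per : ∀ s x, u s (x + P) = u s x)
    (hF_per : ∀ s x, F s (x + P) = F s x)
    -- the adjoint function φ, C¹ in time and C² in space, periodic in space
    (φ φs φx φxx : ℝ → ℝ → ℝ)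
    (hφs : ∀ s ∈ Icc t T, ∀ x : ℝ,
      HasDerivWithinAt (fun τ => φ τ x) (φs s x) (Icc t T) s)
    (hφx : ∀ s ∈ Icc t T, ∀ x : ℝ, HasDerivAt (fun y => φ s y) (φx s x) x)
    (hφxx : ∀ s ∈ Icc t T, ∀ x : ℝ, HasDerivAt (fun y => φx s y) (φxx s x) x)
    (hφs_cont : ContinuousOn (fun p : ℝ × ℝ => φs p.1 p.2) (Icc t T ×ˢ univ))
    (hφx_cont : ContinuousOn (fun p : ℝ × ℝ => φx p.1 p.2) (Icc t T ×ˢ univ))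
    (hφxx_cont : ContinuousOn (fun p : ℝ × ℝ => φxx p.1 p.2) (Icc t T ×ˢ univ))
    (hφ_per : ∀ s x, φ s (x + P) = φ s x)
    -- backward Hamilton–Jacobi equation
    (hφ_hje : ∀ s ∈ Icc t T, ∀ x : ℝ,
      φs s x + (1 / 2) * (φx s x) ^ 2 + u s x * φx s x + D * φxx s x = F s x)
    -- the density ρ, C¹ in time and C² in space, periodic in space
    (ρ ρs ρx ρxx : ℝ → ℝ → ℝ)
    (hρs : ∀ s ∈ Icc t T, ∀ x : ℝ,
      HasDerivWithinAt (fun τ => ρ τ x) (ρs s x) (Icc t T) s)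
    (hρx : ∀ s ∈ Icc t T, ∀ x : ℝ, HasDerivAt (fun y => ρ s y) (ρx s x) x)
    (hρxx : ∀ s ∈ Icc t T, ∀ x : ℝ, HasDerivAt (fun y => ρx s y) (ρxx s x) x)
    (hρs_cont : ContinuousOn (fun p : ℝ × ℝ => ρs p.1 p.2) (Icc t T ×ˢ univ))
    (hρx_cont : ContinuousOn (fun p : ℝ × ℝ => ρx p.1 p.2) (Icc t T ×ˢ univ))
    (hρxx_cont : ContinuousOn (fun p : ℝ × ℝ => ρxx p.1 p.2) (Icc t T ×ˢ univ))
    (hρ_per : ∀ s x, ρ s (x + P) = ρ s x)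
    -- forward Fokker–Planck equation ∂ₛρ + ∂ₓ((u + ∂ₓφ)ρ) = D ∂ₓ²ρ
    (hρ_pde : ∀ s ∈ Icc t T, ∀ x : ℝ,
      HasDerivAt (fun y => (u s y + φx s y) * ρ s y)
        (D * ρxx s x - ρs s x) x) :
    ∀ s ∈ Icc t T,
      HasDerivWithinAt (fun τ => ∫ x in (0:ℝ)..P, ρ τ x * φ τ x)
        (∫ x in (0:ℝ)..P, ((1 / 2) * (φx s x) ^ 2 + F s x) * ρ s x)
        (Icc t T) s := by
  intro s hs
  have slice : ∀ {g : ℝ → ℝ → ℝ},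
      ContinuousOn (fun p : ℝ × ℝ => g p.1 p.2) (Icc t T ×ˢ univ) → Continuous (g s) :=
    fun hg => hg.comp_continuous (f := fun x : ℝ => (s, x)) (by fun_prop) fun x => ⟨hs, mem_univ x⟩
  have hφ_cont : ∀ τ ∈ Icc t T, Continuous (φ τ) := fun τ hτ =>
    continuous_iff_continuousAt.2 fun x => (hφx τ hτ x).continuousAt
  have hρ_cont : ∀ τ ∈ Icc t T, Continuous (ρ τ) := fun τ hτ =>
    continuous_iff_continuousAt.2 fun x => (hρx τ hτ x).continuousAt
  have ht : t ∈ Icc t T := left_mem_Icc.2 htT.le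
  obtain ⟨A, hA⟩ := exists_bound_of_continuousOn_timeDeriv (a := 0) (b := P) htT.le
    (hφ_cont t ht) hφs hφs_cont
  obtain ⟨B, hB⟩ := exists_bound_of_continuousOn_timeDeriv (a := 0) (b := P) htT.le
    (hρ_cont t ht) hρs hρs_cont
  have hderiv : HasDerivWithinAt (fun τ => ∫ x in (0:ℝ)..P, ρ τ x * φ τ x)
      (∫ x in (0:ℝ)..P, (ρs s x * φ s x + ρ s x * φs s x)) (Icc t T) s := by
    refine hasDerivWithinAt_intervalIntegral_of_bound (C := B * A + B * A)
      (f := fun τ x => ρ τ x * φ τ x) (f' := fun τ x => ρs τ x * φ τ x + ρ τ x * φs τ x)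
      (fun τ hτ => (hρ_cont τ hτ).mul (hφ_cont τ hτ))
      (fun τ hτ x => (hρs τ hτ x).mul (hφs τ hτ x)) (fun τ hτ x hx => ?_) hs
    obtain ⟨hA₁, hA₂⟩ := hA τ hτ x hx
    obtain ⟨hB₁, hB₂⟩ := hB τ hτ x hx
    have hB0 : 0 ≤ B := (norm_nonneg _).trans hB₁
    refine norm_add_le_of_le ?_ ?_ <;> rw [norm_mul] <;> gcongr
  convert hderiv using 1
  have cφ := hφ_cont s hs
  have cρ := hρ_cont s hs
  have cφs := slice hφs_cont
  have cρs := slice hρs_cont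
  have cφx := slice hφx_cont
  have cF := slice hF_cont
  have hG : ∀ x, HasDerivAt
      (fun y => D * (ρx s y * φ s y - ρ s y * φx s y) - (u s y + φx s y) * ρ s y * φ s y)
      ((ρs s x * φ s x + ρ s x * φs s x) - ((1 / 2) * (φx s x) ^ 2 + F s x) * ρ s x) x := by
    intro x
    refine (((((hρxx s hs x).mul (hφx s hs x)).sub
      ((hρx s hs x).mul (hφxx s hs x))).const_mul D).sub
      ((hρ_pde s hs x).mul (hφx s hs x))).congr_deriv ?_
    linear_combination -ρ s x * hφ_hje s hs x
  have hint := integral_eq_sub_of_hasDerivAt (a := 0) (b := P) (fun x _ => hG x)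
    (Continuous.intervalIntegrable (by fun_prop) _ _)
  rw [intervalIntegral.integral_sub (Continuous.intervalIntegrable (by fun_prop) _ _)
    (Continuous.intervalIntegrable (by fun_prop) _ _)] at hint
  have hφ0 := (show Function.Periodic (φ s) P from hφ_per s).eq
  have hρ0 := (show Function.Periodic (ρ s) P from hρ_per s).eq
  have hu0 := (show Function.Periodic (u s) P from hu_per s).eq
  have hφx0 := (hasDerivAt_periodic (hφ_per s) (hφx s hs)).eq
  have hρx0 := (hasDerivAt_periodic (hρ_per s) (hρx s hs)).eq
  rw [hφ0, hρ0, hu0, hφx0, hρx0, sub_self] at hint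
  exact (sub_eq_zero.1 hint).symm
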